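/- arXiv:1712.09962 — 2 statements merged into one kernel-verified Lean document; each statement's English description precedes it below -/
import Mathlib

section
/- Let d ≥ 3 and let Q : ℝ^d → ℝ be a Schwartz function satisfying the elliptic equation −ΔQ(x) + Q(x) = |Q(x)|^{4/(d-1)} Q(x) for all x ∈ ℝ^d. Then ∫_{ℝ^d} |∇Q(x)|² dx = d ∫_{ℝ^d} Q(x)² dx and ∫_{ℝ^d} |Q(x)|^{2(d+1)/(d-1)} dx = (d+1) ∫_{ℝ^d} Q(x)² dx. -/
open MeasureTheory
open scoped BigOperators

open LineDeriv SchwartzMap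

section SchwartzIdentities

variable {D : Type*} [NormedAddCommGroup D] [NormedSpace ℝ D]

namespace SchwartzMap

theorem smulLeftCLM_clm_apply (φ : D →L[ℝ] ℝ) (f : 𝓢(D, ℝ)) (x : D) :
    smulLeftCLM ℝ φ f x = φ x * f x := by
  rw [smulLeftCLM_apply_apply (by fun_prop), smul_eq_mul]

theorem lineDerivOp_smulLeftCLM_clm (φ : D →L[ℝ] ℝ) (f : 𝓢(D, ℝ)) (v x : D) :
    ∂_{v} (smulLeftCLM ℝ φ f) x = φ v * f x + φ x * ∂_{v} f x := by
  have h : (smulLeftCLM ℝ φ f : D → ℝ) = φ * f :=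
    funext (smulLeftCLM_clm_apply φ f)
  rw [lineDerivOp_apply_eq_fderiv, lineDerivOp_apply_eq_fderiv, h,
    (φ.hasFDerivAt.mul (f.hasFDerivAt x)).fderiv]
  simp only [add_apply, smul_apply, smul_eq_mul]
  ring

theorem lineDerivOp_lineDerivOp_comm (f : 𝓢(D, ℝ)) (v w x : D) :
    ∂_{v} (∂_{w} f) x = ∂_{w} (∂_{v} f) x := by
  have key (v w : D) : ∂_{v} (∂_{w} f) x = fderiv ℝ (fderiv ℝ f) x v w := by
    have h : DifferentiableAt ℝ (fderiv ℝ f) x := (fderivCLM ℝ D ℝ f).differentiableAt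
    rw [lineDerivOp_apply_eq_fderiv]
    change fderiv ℝ (fun y ↦ fderiv ℝ f y w) x v = _
    simp [fderiv_clm_apply h (differentiableAt_const w)]
  rw [key, key]
  exact ((f.smooth 2).contDiffAt.isSymmSndFDerivAt (by simp)).eq v w

variable [FiniteDimensional ℝ D] [MeasurableSpace D] [BorelSpace D]
  (μ : Measure D) [μ.IsAddHaarMeasure]

theorem integrable_mul (f g : 𝓢(D, ℝ)) : Integrable (fun x ↦ f x * g x) μ :=
  (pairing (ContinuousLinearMap.mul ℝ ℝ) f g).integrable

theorem integrable_clm_mul_mul (φ : D →L[ℝ] ℝ) (f g : 𝓢(D, ℝ)) :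
    Integrable (fun x ↦ φ x * f x * g x) μ := by
  simpa only [smulLeftCLM_clm_apply] using integrable_mul μ (smulLeftCLM ℝ φ f) g

theorem integral_clm_mul_mul_lineDerivOp (φ : D →L[ℝ] ℝ) (f g : 𝓢(D, ℝ)) (v : D) :
    ∫ x, φ x * f x * ∂_{v} g x ∂μ
      = -(φ v * ∫ x, f x * g x ∂μ) - ∫ x, φ x * ∂_{v} f x * g x ∂μ := by
  have h := integral_mul_lineDerivOp_right_eq_neg_left (μ := μ) (smulLeftCLM ℝ φ f) g v
  simp only [smulLeftCLM_clm_apply, lineDerivOp_smulLeftCLM_clm, add_mul] at h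
  simp only [mul_assoc (φ v)] at h
  rw [integral_add ((integrable_mul μ f g).const_mul _) (integrable_clm_mul_mul μ φ _ g),
    integral_const_mul] at h
  rw [h]
  ring

theorem integral_clm_mul_self_mul_lineDerivOp (φ : D →L[ℝ] ℝ) (f : 𝓢(D, ℝ)) (v : D) :
    ∫ x, φ x * f x * ∂_{v} f x ∂μ = -(φ v / 2 * ∫ x, f x ^ 2 ∂μ) := by
  have h := integral_clm_mul_mul_lineDerivOp μ φ f f v
  have h' : ∫ x, φ x * ∂_{v} f x * f x ∂μ = ∫ x, φ x * f x * ∂_{v} f x ∂μ := by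
    congr 1 with x
    ring
  rw [h'] at h
  simp only [← sq] at h
  linarith

theorem integral_mul_lineDerivOp_lineDerivOp (f : 𝓢(D, ℝ)) (v : D) :
    ∫ x, f x * ∂_{v} (∂_{v} f) x ∂μ = -∫ x, ∂_{v} f x ^ 2 ∂μ := by
  simp only [integral_mul_lineDerivOp_right_eq_neg_left (μ := μ) f, ← sq]

theorem integral_clm_mul_lineDerivOp_mul_lineDerivOp_lineDerivOp (φ : D →L[ℝ] ℝ) (f : 𝓢(D, ℝ))
    (v w : D) :
    ∫ x, φ x * ∂_{v} f x * ∂_{w} (∂_{w} f) x ∂μ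
      = φ v / 2 * (∫ x, ∂_{w} f x ^ 2 ∂μ) - φ w * ∫ x, ∂_{v} f x * ∂_{w} f x ∂μ := by
  have h := integral_clm_mul_mul_lineDerivOp μ φ (∂_{v} f) (∂_{w} f) w
  have h' := integral_clm_mul_self_mul_lineDerivOp μ φ (∂_{w} f) v
  have h'' : ∫ x, φ x * ∂_{w} (∂_{v} f) x * ∂_{w} f x ∂μ
      = ∫ x, φ x * ∂_{w} f x * ∂_{v} (∂_{w} f) x ∂μ := by
    congr 1 with x
    rw [lineDerivOp_lineDerivOp_comm f v w]
    ring
  rw [h'', h'] at h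
  rw [h]
  ring

/-- If `N = |Q| ^ p * Q` is Schwartz, then `∂ᵥ (Q * N) = (p + 2) * N * ∂ᵥ Q`; this is the
resulting integrated identity against a linear weight. -/
theorem integral_clm_mul_rpow_mul_lineDerivOp (φ : D →L[ℝ] ℝ) (Q N : 𝓢(D, ℝ)) (v : D) {p : ℝ}
    (hp : 0 < p) (hN : ∀ x, N x = |Q x| ^ p * Q x) :
    (p + 2) * ∫ x, φ x * N x * ∂_{v} Q x ∂μ = -(φ v * ∫ x, N x * Q x ∂μ) := by
  have hQN : (fun t : ℝ ↦ |t| ^ (p + 2)) ∘ Q = N * Q := by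
    ext x
    rw [Function.comp_apply, Pi.mul_apply, hN,
      Real.rpow_add_of_nonneg (abs_nonneg _) hp.le zero_le_two, Real.rpow_two, sq_abs]
    ring
  have hderiv (x : D) : ∂_{v} N x * Q x + N x * ∂_{v} Q x = (p + 2) * N x * ∂_{v} Q x := by
    have h₁ := (hasDerivAt_abs_rpow (Q x) (show 1 < p + 2 by linarith)).comp_hasFDerivAt x
      (Q.hasFDerivAt x)
    have h₂ := (N.hasFDerivAt x).mul (Q.hasFDerivAt x)
    have h := congrArg (fun L : D →L[ℝ] ℝ ↦ L v) ((hQN ▸ h₁).unique h₂)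
    simp only [add_apply, smul_apply, smul_eq_mul, add_sub_cancel_right] at h
    simp only [lineDerivOp_apply_eq_fderiv]
    rw [hN] at h ⊢
    linarith
  have h := integral_clm_mul_mul_lineDerivOp μ φ N Q v
  have h' : (p + 1) * ∫ x, φ x * N x * ∂_{v} Q x ∂μ = ∫ x, φ x * ∂_{v} N x * Q x ∂μ := by
    rw [← integral_const_mul]
    congr 1 with x
    linear_combination (-φ x) * hderiv x
  linarith

end SchwartzMap

end SchwartzIdentities

/-- consequences of the Pohozaev identities. -/
theorem pohozaev_consequences
    (d : ℕ) (hd : 3 ≤ d) (Q : SchwartzMap (EuclideanSpace ℝ (Fin d)) ℝ)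
    (hQ : ∀ x : EuclideanSpace ℝ (Fin d),
      -(∑ j : Fin d,
          fderiv ℝ (fun y : EuclideanSpace ℝ (Fin d) =>
              fderiv ℝ (⇑Q) y (EuclideanSpace.single j 1)) x (EuclideanSpace.single j 1))
        + Q x = |Q x| ^ ((4 : ℝ) / ((d : ℝ) - 1)) * Q x) :
    (∫ x : EuclideanSpace ℝ (Fin d),
        ∑ j : Fin d, (fderiv ℝ (⇑Q) x (EuclideanSpace.single j 1)) ^ 2)
      = (d : ℝ) * (∫ x : EuclideanSpace ℝ (Fin d), (Q x) ^ 2)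
    ∧ (∫ x : EuclideanSpace ℝ (Fin d), |Q x| ^ ((2 * ((d : ℝ) + 1)) / ((d : ℝ) - 1)))
      = ((d : ℝ) + 1) * (∫ x : EuclideanSpace ℝ (Fin d), (Q x) ^ 2) := by
  set p : ℝ := 4 / ((d : ℝ) - 1) with hp
  have hd' : (3 : ℝ) ≤ d := by exact_mod_cast hd
  have hd1 : (d : ℝ) - 1 ≠ 0 := by linarith
  have hp0 : 0 < p := div_pos four_pos (by linarith)
  let e : Fin d → EuclideanSpace ℝ (Fin d) := fun j ↦ EuclideanSpace.single j 1
  let φ : Fin d → EuclideanSpace ℝ (Fin d) →L[ℝ] ℝ := fun j ↦ EuclideanSpace.proj j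
  have hφ (j k : Fin d) : φ j (e k) = if j = k then 1 else 0 := by
    simp [φ, e]
  let N : 𝓢(EuclideanSpace ℝ (Fin d), ℝ) := Q - ∑ k, ∂_{e k} (∂_{e k} Q)
  have hNx (x) : N x = Q x - ∑ k, ∂_{e k} (∂_{e k} Q) x := by
    simp [N]
  have hN (x) : N x = |Q x| ^ p * Q x := by
    rw [← hQ x, hNx, neg_add_eq_sub]
    rfl
  set A : Fin d → ℝ := fun k ↦ ∫ x, ∂_{e k} Q x ^ 2 with hA
  set M : ℝ := ∫ x, Q x ^ 2 with hM
  set P : ℝ := ∫ x, N x * Q x with hP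
  have hgrad : (∫ x : EuclideanSpace ℝ (Fin d),
      ∑ j : Fin d, (fderiv ℝ (⇑Q) x (EuclideanSpace.single j 1)) ^ 2) = ∑ k, A k := by
    refine integral_finsetSum _ fun k _ ↦ ?_
    simpa only [← sq] using! integrable_mul volume (∂_{e k} Q) (∂_{e k} Q)
  have hpow : (∫ x : EuclideanSpace ℝ (Fin d),
      |Q x| ^ ((2 * ((d : ℝ) + 1)) / ((d : ℝ) - 1))) = P := by
    congr 1 with x
    have : (2 * ((d : ℝ) + 1)) / ((d : ℝ) - 1) = p + 2 := by
      rw [hp]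
      field_simp
      ring
    rw [hN, this, Real.rpow_add_of_nonneg (abs_nonneg _) hp0.le zero_le_two, Real.rpow_two,
      sq_abs]
    ring
  have henergy : P = M + ∑ k, A k := by
    have h (x) : N x * Q x = Q x * Q x - ∑ k, Q x * ∂_{e k} (∂_{e k} Q) x := by
      rw [hNx, sub_mul, Finset.sum_mul]
      simp only [mul_comm]
    simp only [hP, h]
    rw [integral_sub (integrable_mul _ _ _)
        (integrable_finsetSum _ fun k _ ↦ integrable_mul _ _ _),
      integral_finsetSum _ fun k _ ↦ integrable_mul _ _ _]
    simp only [integral_mul_lineDerivOp_lineDerivOp, Finset.sum_neg_distrib, ← sq, sub_neg_eq_add,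
      hM, hA]
  have hvirial (j : Fin d) : -P = (p + 2) * (-(M / 2) - ((∑ k, A k) / 2 - A j)) := by
    have h := integral_clm_mul_rpow_mul_lineDerivOp volume (φ j) Q N (e j) hp0 hN
    have h' (x) : φ j x * N x * ∂_{e j} Q x = φ j x * Q x * ∂_{e j} Q x
        - ∑ k, φ j x * ∂_{e j} Q x * ∂_{e k} (∂_{e k} Q) x := by
      rw [hNx, ← Finset.mul_sum]
      ring
    simp only [h'] at h
    rw [integral_sub (integrable_clm_mul_mul _ _ _ _)
        (integrable_finsetSum _ fun k _ ↦ integrable_clm_mul_mul _ _ _ _),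
      integral_finsetSum _ fun k _ ↦ integrable_clm_mul_mul _ _ _ _] at h
    simp only [integral_clm_mul_lineDerivOp_mul_lineDerivOp_lineDerivOp,
      integral_clm_mul_self_mul_lineDerivOp, hφ, ite_mul, one_mul, zero_mul,
      Finset.sum_sub_distrib, Finset.sum_ite_eq, Finset.mem_univ, if_true, ← Finset.mul_sum,
      ← sq] at h
    rw [← h]
    simp only [hA, hM]
    ring
  have hsum := Finset.sum_congr (rfl : (Finset.univ : Finset (Fin d)) = _) fun j _ ↦ hvirial j
  simp only [← Finset.mul_sum, Finset.sum_sub_distrib, Finset.sum_const, Finset.card_univ,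
    Fintype.card_fin, nsmul_eq_mul] at hsum
  have hp2 : (p + 2) * ((d : ℝ) - 1) = 2 * (d + 1) := by
    rw [hp]
    field_simp
    ring
  have hmain : ∑ k, A k = d * M := by
    rw [henergy] at hsum
    linear_combination (-(d - 1) / 2 : ℝ) * hsum
      - (-(d * (M / 2)) - (d * ((∑ k, A k) / 2) - ∑ k, A k)) / 2 * hp2
  rw [hgrad, hpow]
  exact ⟨hmain, by rw [henergy, hmain]; ring⟩
end

section
/- Let d ≥ 3, let w : ℝ^d × ℝ^d → ℝ be a bounded measurable function satisfying w(x,y) = w(y,x) for all x, y, let u : ℝ^d → ℂ be a Schwartz function, and let ξ ∈ ℝ^d. Let u^ξ denote the function z ↦ e^{i⟨z,ξ⟩} u(z). Then ∬_{ℝ^d × ℝ^d} w(x,y) { |u^ξ(y)|² |∇u^ξ(x)|² − Im[conj(u^ξ) ∇u^ξ](x) · Im[conj(u^ξ) ∇u^ξ](y) } dx dy = ∬_{ℝ^d × ℝ^d} w(x,y) { |u(y)|² |∇u(x)|² − Im[conj(u) ∇u](x) · Im[conj(u) ∇u](y) } dx dy. -/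
open MeasureTheory Complex
open scoped BigOperators RealInnerProductSpace

/-- The vector of partial derivatives of `f` at `x`. -/
noncomputable def gradVec (d : ℕ) (f : EuclideanSpace ℝ (Fin d) → ℂ)
    (x : EuclideanSpace ℝ (Fin d)) (j : Fin d) : ℂ :=
  fderiv ℝ f x (EuclideanSpace.single j 1)

/-- The vector `Im[conj(f) ∇f](x)`. -/
noncomputable def momVec (d : ℕ) (f : EuclideanSpace ℝ (Fin d) → ℂ)
    (x : EuclideanSpace ℝ (Fin d)) (j : Fin d) : ℝ :=
  ((starRingEnd ℂ) (f x) * gradVec d f x j).im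

/-- The Galilean modulation `x ↦ e^{i⟨x,ξ⟩} f(x)`. -/
noncomputable def modulate (d : ℕ) (ξ : EuclideanSpace ℝ (Fin d))
    (f : EuclideanSpace ℝ (Fin d) → ℂ) : EuclideanSpace ℝ (Fin d) → ℂ :=
  fun y => Complex.exp (Complex.I * (⟪y, ξ⟫ : ℝ)) * f y

theorem gradVec_modulate {d : ℕ} (ξ : EuclideanSpace ℝ (Fin d))
    {f : EuclideanSpace ℝ (Fin d) → ℂ} {x : EuclideanSpace ℝ (Fin d)}
    (hf : DifferentiableAt ℝ f x) (j : Fin d) :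
    gradVec d (modulate d ξ f) x j =
      Complex.exp (Complex.I * (⟪x, ξ⟫ : ℝ)) * (gradVec d f x j + Complex.I * ξ j * f x) := by
  have hinner : HasFDerivAt (fun y : EuclideanSpace ℝ (Fin d) => ((⟪y, ξ⟫ : ℝ) : ℂ))
      (Complex.ofRealCLM.comp ((innerSL ℝ).flip ξ)) x :=
    Complex.ofRealCLM.hasFDerivAt.comp x ((innerSL ℝ).flip ξ).hasFDerivAt
  have h := ((hinner.const_mul Complex.I).cexp.mul hf.hasFDerivAt).fderiv
  have hξ : (innerSL ℝ).flip ξ (EuclideanSpace.single j 1) = ξ j := by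
    change ⟪EuclideanSpace.single j (1 : ℝ), ξ⟫ = ξ j
    simp [EuclideanSpace.inner_single_left]
  have hm : modulate d ξ f =
      (fun y => Complex.exp (Complex.I * ((⟪y, ξ⟫ : ℝ) : ℂ))) * f := rfl
  simp only [gradVec, hm]
  rw [h]
  simp [hξ, -flip_innerSL_real]
  ring

theorem norm_sq_modulate {d : ℕ} (ξ : EuclideanSpace ℝ (Fin d))
    (f : EuclideanSpace ℝ (Fin d) → ℂ) (x : EuclideanSpace ℝ (Fin d)) :
    ‖modulate d ξ f x‖ ^ 2 = ‖f x‖ ^ 2 := by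
  simp [modulate, mul_comm Complex.I, Complex.norm_exp_ofReal_mul_I]

theorem norm_sq_gradVec_modulate {d : ℕ} (ξ : EuclideanSpace ℝ (Fin d))
    {f : EuclideanSpace ℝ (Fin d) → ℂ} {x : EuclideanSpace ℝ (Fin d)}
    (hf : DifferentiableAt ℝ f x) (j : Fin d) :
    ‖gradVec d (modulate d ξ f) x j‖ ^ 2 =
      ‖gradVec d f x j‖ ^ 2 + 2 * ξ j * momVec d f x j + ξ j ^ 2 * ‖f x‖ ^ 2 := by
  rw [gradVec_modulate ξ hf, norm_mul, mul_comm Complex.I (_ : ℝ),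
    Complex.norm_exp_ofReal_mul_I, one_mul]
  simp only [momVec, Complex.sq_norm, Complex.normSq_apply]
  simp
  ring

theorem momVec_modulate {d : ℕ} (ξ : EuclideanSpace ℝ (Fin d))
    {f : EuclideanSpace ℝ (Fin d) → ℂ} {x : EuclideanSpace ℝ (Fin d)}
    (hf : DifferentiableAt ℝ f x) (j : Fin d) :
    momVec d (modulate d ξ f) x j = momVec d f x j + ξ j * ‖f x‖ ^ 2 := by
  have he : (starRingEnd ℂ) (Complex.exp (Complex.I * (⟪x, ξ⟫ : ℝ))) *
      Complex.exp (Complex.I * (⟪x, ξ⟫ : ℝ)) = 1 := by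
    rw [← Complex.exp_conj, ← Complex.exp_add]
    simp
  have h : (starRingEnd ℂ) (modulate d ξ f x) * gradVec d (modulate d ξ f) x j =
      (starRingEnd ℂ) (f x) * (gradVec d f x j + Complex.I * ξ j * f x) := by
    rw [gradVec_modulate ξ hf, modulate, map_mul]
    linear_combination
      ((starRingEnd ℂ) (f x) * (gradVec d f x j + Complex.I * ξ j * f x)) * he
  simp only [momVec]
  rw [h, Complex.sq_norm, Complex.normSq_apply]
  simp
  ring

theorem interaction_density_modulate {d : ℕ} (ξ : EuclideanSpace ℝ (Fin d))
    {f : EuclideanSpace ℝ (Fin d) → ℂ} (hf : Differentiable ℝ f)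
    (x y : EuclideanSpace ℝ (Fin d)) :
    ‖modulate d ξ f y‖ ^ 2 * (∑ j : Fin d, ‖gradVec d (modulate d ξ f) x j‖ ^ 2)
        - ∑ j : Fin d, momVec d (modulate d ξ f) x j * momVec d (modulate d ξ f) y j =
      (‖f y‖ ^ 2 * (∑ j : Fin d, ‖gradVec d f x j‖ ^ 2)
        - ∑ j : Fin d, momVec d f x j * momVec d f y j)
      + ((∑ j : Fin d, ξ j * momVec d f x j) * ‖f y‖ ^ 2
        - ‖f x‖ ^ 2 * ∑ j : Fin d, ξ j * momVec d f y j) := by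
  simp only [norm_sq_modulate, norm_sq_gradVec_modulate ξ (hf _), momVec_modulate ξ (hf _),
    Finset.mul_sum, Finset.sum_mul, ← Finset.sum_sub_distrib, ← Finset.sum_add_distrib]
  refine Finset.sum_congr rfl fun j _ => ?_
  ring

theorem integral_integral_mul_antisymm {α : Type*} [MeasurableSpace α] {μ : Measure α}
    [SFinite μ] {w : α × α → ℝ} (hw : ∀ x y, w (x, y) = w (y, x)) {F : α × α → ℝ} {a b : α → ℝ}
    (hF : Integrable (fun p => w p * F p) (μ.prod μ))
    (hG : Integrable (fun p => w p * (a p.1 * b p.2)) (μ.prod μ)) :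
    ∫ x, ∫ y, w (x, y) * (F (x, y) + (a x * b y - b x * a y)) ∂μ ∂μ =
      ∫ x, ∫ y, w (x, y) * F (x, y) ∂μ ∂μ := by
  have hH : Integrable (fun p : α × α => w p * (b p.1 * a p.2)) (μ.prod μ) := by
    refine hG.swap.congr (Filter.Eventually.of_forall fun p => ?_)
    simp only [Function.comp_apply, Prod.swap, hw p.2 p.1]
    ring
  have hswap : ∫ p, w p * (b p.1 * a p.2) ∂μ.prod μ =
      ∫ p, w p * (a p.1 * b p.2) ∂μ.prod μ := by
    rw [← integral_prod_swap]
    refine integral_congr_ae (Filter.Eventually.of_forall fun p => ?_)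
    simp only [Prod.swap, hw p.2 p.1]
    ring
  have hsplit : (fun p : α × α => w p * (F p + (a p.1 * b p.2 - b p.1 * a p.2))) =
      fun p => w p * F p + (w p * (a p.1 * b p.2) - w p * (b p.1 * a p.2)) := by
    funext p
    ring
  have hD : Integrable (fun p : α × α => w p * (F p + (a p.1 * b p.2 - b p.1 * a p.2)))
      (μ.prod μ) := by
    rw [hsplit]
    exact hF.add (hG.sub hH)
  rw [← integral_prod _ hD, ← integral_prod _ hF, hsplit,
    integral_add hF (g := fun p => w p * (a p.1 * b p.2) - w p * (b p.1 * a p.2)) (hG.sub hH),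
    integral_sub hG hH, hswap, sub_self, add_zero]

theorem SchwartzMap.memLp_gradVec {d : ℕ} (u : SchwartzMap (EuclideanSpace ℝ (Fin d)) ℂ)
    (j : Fin d) : MemLp (fun x => gradVec d u x j) 2 :=
  (SchwartzMap.evalCLM ℝ (EuclideanSpace ℝ (Fin d)) ℂ (EuclideanSpace.single j (1 : ℝ))
    (SchwartzMap.fderivCLM ℝ (EuclideanSpace ℝ (Fin d)) ℂ u)).memLp 2 volume

theorem SchwartzMap.integrable_momVec {d : ℕ} (u : SchwartzMap (EuclideanSpace ℝ (Fin d)) ℂ)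
    (j : Fin d) : Integrable (fun x => momVec d u x j) :=
  ((u.memLp 2).star.integrable_mul (u.memLp_gradVec j)).im

/-- Galilean invariance of the weighted interaction quantity. -/
theorem interaction_quantity_galilean_invariant
    (d : ℕ) (hd : 3 ≤ d)
    (w : EuclideanSpace ℝ (Fin d) × EuclideanSpace ℝ (Fin d) → ℝ)
    (hw_bdd : ∃ C : ℝ, ∀ p, |w p| ≤ C) (hw_meas : Measurable w)
    (hw_symm : ∀ x y : EuclideanSpace ℝ (Fin d), w (x, y) = w (y, x))
    (u : SchwartzMap (EuclideanSpace ℝ (Fin d)) ℂ) (ξ : EuclideanSpace ℝ (Fin d)) :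
    (∫ x : EuclideanSpace ℝ (Fin d), ∫ y : EuclideanSpace ℝ (Fin d),
        w (x, y) *
          (‖modulate d ξ (⇑u) y‖ ^ 2 * (∑ j : Fin d, ‖gradVec d (modulate d ξ (⇑u)) x j‖ ^ 2)
            - ∑ j : Fin d, momVec d (modulate d ξ (⇑u)) x j * momVec d (modulate d ξ (⇑u)) y j))
    = ∫ x : EuclideanSpace ℝ (Fin d), ∫ y : EuclideanSpace ℝ (Fin d),
        w (x, y) *
          (‖u y‖ ^ 2 * (∑ j : Fin d, ‖gradVec d (⇑u) x j‖ ^ 2)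
            - ∑ j : Fin d, momVec d (⇑u) x j * momVec d (⇑u) y j) := by
  obtain ⟨C, hC⟩ := hw_bdd
  have hρ : Integrable (fun x => ‖u x‖ ^ 2) := (u.memLp 2).integrable_norm_pow two_ne_zero
  have hgrad : Integrable (fun x => ∑ j : Fin d, ‖gradVec d u x j‖ ^ 2) :=
    integrable_finsetSum _ fun j _ => (u.memLp_gradVec j).integrable_norm_pow two_ne_zero
  have hmom : Integrable (fun x => ∑ j : Fin d, ξ j * momVec d u x j) :=
    integrable_finsetSum _ fun j _ => (u.integrable_momVec j).const_mul (ξ j)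
  have hbdd {F : EuclideanSpace ℝ (Fin d) × EuclideanSpace ℝ (Fin d) → ℝ}
      (hF : Integrable F (volume.prod volume)) :
      Integrable (fun p => w p * F p) (volume.prod volume) :=
    hF.bdd_mul hw_meas.aestronglyMeasurable (Filter.Eventually.of_forall hC)
  have hF : Integrable (fun p : EuclideanSpace ℝ (Fin d) × EuclideanSpace ℝ (Fin d) =>
      ‖u p.2‖ ^ 2 * (∑ j : Fin d, ‖gradVec d u p.1 j‖ ^ 2)
        - ∑ j : Fin d, momVec d u p.1 j * momVec d u p.2 j) (volume.prod volume) := by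
    refine Integrable.sub ?_ (integrable_finsetSum _ fun j _ =>
      (u.integrable_momVec j).mul_prod (u.integrable_momVec j))
    simpa only [mul_comm] using hgrad.mul_prod hρ
  simp only [interaction_density_modulate ξ u.differentiable]
  exact integral_integral_mul_antisymm hw_symm (hbdd hF) (hbdd (hmom.mul_prod hρ))
end
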